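/- Let S¹ be the unit circle in the complex plane with the induced metric, μ a Borel probability measure on S¹, and f : S¹ → S¹ a μ-expansive homeomorphism. Then the support of μ is contained in the nonwandering set Ω(f) of f. -/

import Mathlib

open MeasureTheory Set Filter

noncomputable instance : MeasurableSpace Circle := borel Circle
instance : BorelSpace Circle := ⟨rfl⟩

/-- `Γ_δ(x)` for a bijection `f`: points whose full orbit stays `δ`-close to that of `x`. -/
def Gamma {X : Type*} [MetricSpace X] (f : Equiv.Perm X) (δ : ℝ) (x : X) : Set X :=
  {y | ∀ n : ℤ, dist ((f ^ n) x) ((f ^ n) y) ≤ δ}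

/-- `f` is `μ`-expansive. -/
def MeasureExpansive {X : Type*} [MetricSpace X] [MeasurableSpace X]
    (μ : Measure X) (f : Equiv.Perm X) : Prop :=
  ∃ δ > (0 : ℝ), ∀ x : X, μ (Gamma f δ x) = 0

/-- The support of a measure: points all of whose open neighborhoods have positive measure. -/
def measSupport {X : Type*} [MetricSpace X] [MeasurableSpace X] (μ : Measure X) : Set X :=
  {x | ∀ U : Set X, IsOpen U → x ∈ U → 0 < μ U}

/-- The nonwandering set of `f`. -/
def nonwandering {X : Type*} [TopologicalSpace X] (f : X → X) : Set X :=
  {x | ∀ U : Set X, IsOpen U → x ∈ U →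
    ∃ n : ℕ, 0 < n ∧ ∃ y ∈ U, f^[n] y ∈ U}

lemma Circle.finite_setOf_re_eq (c : ℝ) : {z : Circle | (z : ℂ).re = c}.Finite := by
  refine Set.Finite.of_finite_image (f := ((↑) : Circle → ℂ)) ?_ Circle.coe_injective.injOn
  refine ((Set.finite_singleton (⟨c, -√(1 - c ^ 2)⟩ : ℂ)).insert ⟨c, √(1 - c ^ 2)⟩).subset ?_
  rintro _ ⟨z, rfl, rfl⟩
  have h := Circle.normSq_coe z
  rw [Complex.normSq_apply] at h
  have h' : 1 - (z : ℂ).re ^ 2 = (z : ℂ).im ^ 2 := by linarith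
  rw [h', Real.sqrt_sq_eq_abs]
  rcases abs_choice (z : ℂ).im with h | h <;> simp [h]

lemma Circle.finite_setOf_im_eq (c : ℝ) : {z : Circle | (z : ℂ).im = c}.Finite := by
  refine Set.Finite.of_finite_image (f := ((↑) : Circle → ℂ)) ?_ Circle.coe_injective.injOn
  refine ((Set.finite_singleton (⟨-√(1 - c ^ 2), c⟩ : ℂ)).insert ⟨√(1 - c ^ 2), c⟩).subset ?_
  rintro _ ⟨z, rfl, rfl⟩
  have h := Circle.normSq_coe z
  rw [Complex.normSq_apply] at h
  have h' : 1 - (z : ℂ).im ^ 2 = (z : ℂ).re ^ 2 := by linarith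
  rw [h', Real.sqrt_sq_eq_abs]
  rcases abs_choice (z : ℂ).re with h | h <;> simp [h]

/-- A bounded function with finite fibres takes values in the grid `h ℤ` only finitely often. -/
lemma finite_setOf_exists_eq_int_mul {X : Type*} {g : X → ℝ} (hg : ∀ c, {z | g z = c}.Finite)
    {B : ℝ} (hB : ∀ z, |g z| ≤ B) {h : ℝ} (hh : 0 < h) : {z | ∃ k : ℤ, g z = k * h}.Finite := by
  refine ((Set.finite_Icc (-⌈B / h⌉) ⌈B / h⌉).biUnion fun k _ => hg (k * h)).subset ?_
  rintro z ⟨k, hk⟩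
  have h1 : |(k : ℝ)| ≤ B / h := by
    rw [le_div_iff₀ hh]
    simpa only [hk, abs_mul, abs_of_pos hh] using hB z
  have h2 : |k| ≤ ⌈B / h⌉ := by
    exact_mod_cast h1.trans (Int.le_ceil _)
  exact Set.mem_biUnion (Set.mem_Icc.2 (abs_le.1 h2)) hk

/-- A continuous function on a preconnected set avoiding the grid `h ℤ` oscillates by at
most `h`. -/
lemma IsPreconnected.abs_sub_le_of_forall_ne_int_mul {X : Type*} [TopologicalSpace X] {C : Set X}
    (hC : IsPreconnected C) {g : X → ℝ} (hg : Continuous g) {h : ℝ} (hh : 0 < h)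
    (hne : ∀ z ∈ C, ∀ k : ℤ, g z ≠ k * h) {a b : X} (ha : a ∈ C) (hb : b ∈ C) :
    |g a - g b| ≤ h := by
  wlog hab : g a ≤ g b generalizing a b
  · rw [abs_sub_comm]
    exact this hb ha (le_of_not_ge hab)
  by_contra! hlt
  rw [abs_sub_comm, abs_of_nonneg (sub_nonneg.2 hab)] at hlt
  have h1 : g a ≤ ⌈g a / h⌉ * h := (div_le_iff₀ hh).1 (Int.le_ceil _)
  have h2 : ⌈g a / h⌉ * h < g a + h := by
    have := mul_lt_mul_of_pos_right (Int.ceil_lt_add_one (g a / h)) hh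
    rwa [add_mul, div_mul_cancel₀ _ hh.ne', one_mul] at this
  obtain ⟨z, hz, hgz⟩ := hC.intermediate_value ha hb hg.continuousOn ⟨h1, by linarith⟩
  exact hne z hz _ hgz

/-- Finitely many points cut the circle into pieces of small diameter. -/
lemma Circle.exists_finite_forall_isPreconnected_dist_le {ε : ℝ} (hε : 0 < ε) :
    ∃ F : Set Circle, F.Finite ∧ ∀ C : Set Circle, IsPreconnected C → Disjoint C F →
      ∀ a ∈ C, ∀ b ∈ C, dist a b ≤ ε := by
  have hε2 : 0 < ε / 2 := half_pos hε
  refine ⟨{z | ∃ k : ℤ, (z : ℂ).re = k * (ε / 2)} ∪ {z | ∃ k : ℤ, (z : ℂ).im = k * (ε / 2)},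
    (finite_setOf_exists_eq_int_mul Circle.finite_setOf_re_eq (B := 1) (fun z => ?_) hε2).union
      (finite_setOf_exists_eq_int_mul Circle.finite_setOf_im_eq (B := 1) (fun z => ?_) hε2), ?_⟩
  · exact (Complex.abs_re_le_norm (z : ℂ)).trans_eq z.norm_coe
  · exact (Complex.abs_im_le_norm (z : ℂ)).trans_eq z.norm_coe
  intro C hC hCF a ha b hb
  rw [Set.disjoint_left] at hCF
  have hre := hC.abs_sub_le_of_forall_ne_int_mul
    (g := fun z : Circle => (z : ℂ).re) (by fun_prop) hε2
    (fun z hz k hk => hCF hz (Or.inl ⟨k, hk⟩)) ha hb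
  have him := hC.abs_sub_le_of_forall_ne_int_mul
    (g := fun z : Circle => (z : ℂ).im) (by fun_prop) hε2
    (fun z hz k hk => hCF hz (Or.inr ⟨k, hk⟩)) ha hb
  have hnorm := Complex.norm_le_abs_re_add_abs_im ((a : ℂ) - b)
  rw [Complex.sub_re, Complex.sub_im, ← dist_eq_norm] at hnorm
  have : dist a b = dist (a : ℂ) b := rfl
  linarith

lemma Homeomorph.continuous_toEquiv_zpow {X : Type*} [TopologicalSpace X] (f : X ≃ₜ X) (n : ℤ) :
    Continuous ⇑((f.toEquiv : Equiv.Perm X) ^ n) := by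
  cases n with
  | ofNat n =>
    rw [Int.ofNat_eq_natCast, zpow_natCast, Equiv.Perm.coe_pow]
    exact f.continuous.iterate n
  | negSucc n =>
    rw [zpow_negSucc, ← inv_pow, Equiv.Perm.coe_pow]
    exact f.symm.continuous.iterate (n + 1)

/-- The iterates of a set that never returns to itself are pairwise disjoint. -/
lemma Equiv.Perm.eq_of_zpow_apply_eq {X : Type*} (f : Equiv.Perm X) {U : Set X}
    (hU : ∀ n : ℕ, 0 < n → ∀ y ∈ U, f^[n] y ∉ U) {m n : ℤ} {a b : X} (ha : a ∈ U) (hb : b ∈ U)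
    (hab : (f ^ m) a = (f ^ n) b) : m = n := by
  wlog hmn : m ≤ n generalizing m n a b
  · exact (this hb ha hab.symm (le_of_not_ge hmn)).symm
  by_contra hne
  obtain ⟨k, rfl⟩ := Int.le.dest hmn
  rw [zpow_add, Equiv.Perm.mul_apply, zpow_natCast] at hab
  refine hU k (by omega) b hb ?_
  rw [← Equiv.Perm.coe_pow, ← (f ^ m).injective hab]
  exact ha

theorem support_subset_nonwandering (μ : Measure Circle) [IsProbabilityMeasure μ]
    (f : Circle ≃ₜ Circle) (hf : MeasureExpansive μ f.toEquiv) :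
    measSupport μ ⊆ nonwandering ⇑f := by
  obtain ⟨δ, hδ, hΓ⟩ := hf
  intro x hx U hU hxU
  by_contra! hwand
  have : LocallyConnectedSpace Circle :=
    ChartedSpace.locallyConnectedSpace (EuclideanSpace ℝ (Fin 1)) Circle
  obtain ⟨F, hF, hFC⟩ := Circle.exists_finite_forall_isPreconnected_dist_le hδ
  set g : Equiv.Perm Circle := f.toEquiv
  set I := connectedComponentIn U x
  have hIU : I ⊆ U := connectedComponentIn_subset U x
  have hxI : x ∈ I := mem_connectedComponentIn hxU
  have hfin : {n : ℤ | ∃ p ∈ F, p ∈ ⇑(g ^ n) '' I}.Finite := by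
    refine (hF.biUnion (t := fun p => {n : ℤ | p ∈ ⇑(g ^ n) '' I}) fun p _ =>
      Set.Subsingleton.finite ?_).subset ?_
    · rintro m ⟨a, ha, rfl⟩ n ⟨b, hb, hab⟩
      exact g.eq_of_zpow_apply_eq hwand (hIU ha) (hIU hb) hab.symm
    · rintro n ⟨p, hp, hpn⟩
      exact Set.mem_biUnion hp hpn
  set V : Set Circle := I ∩ ⋂ n ∈ {n : ℤ | ∃ p ∈ F, p ∈ ⇑(g ^ n) '' I},
    {y | dist ((g ^ n) x) ((g ^ n) y) < δ}
  have hVo : IsOpen V := hU.connectedComponentIn.inter <| hfin.isOpen_biInter fun n _ =>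
    isOpen_lt (continuous_const.dist (f.continuous_toEquiv_zpow n)) continuous_const
  have hxV : x ∈ V := ⟨hxI, Set.mem_iInter₂.2 fun n _ => by simpa using hδ⟩
  refine (hx V hVo hxV).ne' (measure_mono_null ?_ (hΓ x))
  intro y hy n
  by_cases hn : ∃ p ∈ F, p ∈ ⇑(g ^ n) '' I
  · exact (Set.mem_iInter₂.1 hy.2 n hn).le
  · refine hFC (⇑(g ^ n) '' I) (isPreconnected_connectedComponentIn.image _
      (f.continuous_toEquiv_zpow n).continuousOn) ?_ _ ⟨x, hxI, rfl⟩ _ ⟨y, hy.1, rfl⟩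
    exact Set.disjoint_left.2 fun p hp hpF => hn ⟨p, hpF, hp⟩
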